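/- Fix n ≥ 2, k ∈ (0,1), θ > 0, and let Y_1,…,Y_n be i.i.d. uniform on [θ(1−k), θ(1+k)]. Define θ̂_ML = Y_(n)/(1+k), θ̂_MU = Y_(1)/(1−k), b_* = θ̂_MU/θ̂_ML, and the estimator θ̂_B2 = ((n+1)/n)·(1 − b_*^{−n})/(1 − b_*^{−n−1})·θ̂_ML (the generalized Bayes estimator for the improper prior θ^{−2}, with index α = n+1). Then θ̂_B2 is unbiased: E[θ̂_B2] = θ for every θ > 0. -/

import Mathlib

open MeasureTheory

/-- The uniform probability distribution on the interval `[a, b]`. -/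
noncomputable def unifIcc (a b : ℝ) : Measure ℝ :=
  (ENNReal.ofReal (b - a))⁻¹ • volume.restrict (Set.Icc a b)

/-- The generalized Bayes estimator `θ̂_B2` for the improper prior `θ^(-2)`:
`θ̂_B2 = ((n+1)/n) (1 - b_*^(-n))/(1 - b_*^(-n-1)) θ̂_ML` where
`θ̂_ML = y_(n)/(1+k)`, `θ̂_MU = y_(1)/(1-k)` and `b_* = θ̂_MU/θ̂_ML`. -/
noncomputable def thetaB2 (n : ℕ) (k : ℝ) (y : Fin n → ℝ) : ℝ :=
  ((n + 1 : ℝ) / n)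
    * (1 - (((⨅ i, y i) / (1 - k)) / ((⨆ i, y i) / (1 + k))) ^ (-(n : ℤ)))
    / (1 - (((⨅ i, y i) / (1 - k)) / ((⨆ i, y i) / (1 + k))) ^ (-(n : ℤ) - 1))
    * ((⨆ i, y i) / (1 + k))

open Set
open scoped ENNReal

/-- The unnormalised moment `∫ s ^ (j - 1)` over the scales `s` for which `s • y` lies in the open
cube `(a, b) ^ n`. -/
noncomputable def scaleMoment {n : ℕ} (a b : ℝ) (j : ℕ) (y : Fin n → ℝ) : ℝ :=
  ((b / ⨆ i, y i) ^ j - (a / ⨅ i, y i) ^ j) / j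

lemma lintegral_zpow_Ioo {p q : ℝ} (hp : 0 < p) (hpq : p ≤ q) {j : ℤ} (hj : j ≠ -1) :
    ∫⁻ t in Ioo p q, ENNReal.ofReal (t ^ j)
      = ENNReal.ofReal ((q ^ (j + 1) - p ^ (j + 1)) / (j + 1)) := by
  have h0 : (0 : ℝ) ∉ uIcc p q := by
    rw [uIcc_of_le hpq]
    exact fun h => absurd h.1 (not_le.2 hp)
  rw [← integral_zpow (Or.inr ⟨hj, h0⟩), intervalIntegral.integral_of_le hpq,
    Measure.restrict_congr_set Ioo_ae_eq_Ioc]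
  refine (ofReal_integral_eq_lintegral_ofReal ?_ ?_).symm
  · exact (intervalIntegrable_iff_integrableOn_Ioc_of_le hpq).1
      (intervalIntegral.intervalIntegrable_zpow (Or.inr h0))
  · refine (ae_restrict_iff' measurableSet_Ioc).2 (.of_forall fun t ht => ?_)
    exact zpow_nonneg (hp.trans ht.1).le j

lemma lintegral_comp_smul_pi {n : ℕ} {c : ℝ} (hc : 0 < c) {g : (Fin n → ℝ) → ℝ≥0∞}
    (hg : Measurable g) :
    ∫⁻ y, g (c • y) = ENNReal.ofReal ((c ^ n)⁻¹) * ∫⁻ y, g y := by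
  have h := Measure.map_addHaar_smul (volume : Measure (Fin n → ℝ)) hc.ne'
  rw [← lintegral_map hg (measurable_const_smul c), h, lintegral_smul_measure]
  simp [abs_of_pos hc]

section Cube

variable {n : ℕ} {a b : ℝ}

lemma iSup_const_smul (c : ℝ) (hc : 0 ≤ c) (y : Fin n → ℝ) :
    (⨆ i, (c • y) i) = c * ⨆ i, y i := by
  simp [Real.mul_iSup_of_nonneg hc]

lemma iInf_const_smul (c : ℝ) (hc : 0 ≤ c) (y : Fin n → ℝ) :
    (⨅ i, (c • y) i) = c * ⨅ i, y i := by
  simp [Real.mul_iInf_of_nonneg hc]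

lemma measurable_iSup_apply : Measurable fun y : Fin n → ℝ => ⨆ i, y i :=
  Measurable.iSup fun i => measurable_pi_apply i

lemma measurable_iInf_apply : Measurable fun y : Fin n → ℝ => ⨅ i, y i :=
  Measurable.iInf fun i => measurable_pi_apply i

lemma measurable_scaleMoment (j : ℕ) :
    Measurable (scaleMoment a b j : (Fin n → ℝ) → ℝ) :=
  (((measurable_const.div measurable_iSup_apply).pow_const j).sub
    ((measurable_const.div measurable_iInf_apply).pow_const j)).div_const _

lemma measurableSet_cube : MeasurableSet (univ.pi fun _ : Fin n => Ioo a b) :=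
  MeasurableSet.univ_pi fun _ => measurableSet_Ioo

lemma scaleMoment_smul {c : ℝ} (hc : 0 < c) (j : ℕ) (y : Fin n → ℝ) :
    scaleMoment a b j (c • y) = (c ^ j)⁻¹ * scaleMoment a b j y := by
  have h (x z : ℝ) : (x / (c * z)) ^ j = (c ^ j)⁻¹ * (x / z) ^ j := by
    rw [div_mul_eq_div_div_swap, div_eq_mul_inv (x / z) c, mul_pow, inv_pow, mul_comm]
  rw [scaleMoment, scaleMoment, iSup_const_smul c hc.le, iInf_const_smul c hc.le, h, h]
  ring

variable [NeZero n]

lemma mem_cube_iff {y : Fin n → ℝ} :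
    y ∈ (univ.pi fun _ : Fin n => Ioo a b) ↔ a < (⨅ i, y i) ∧ (⨆ i, y i) < b := by
  constructor
  · intro h
    obtain ⟨i, hi⟩ := exists_eq_ciInf_of_finite (f := y)
    obtain ⟨j, hj⟩ := exists_eq_ciSup_of_finite (f := y)
    exact ⟨hi ▸ (h i trivial).1, hj ▸ (h j trivial).2⟩
  · intro h i _
    exact ⟨h.1.trans_le (ciInf_le (finite_range y).bddBelow i),
      (le_ciSup (finite_range y).bddAbove i).trans_lt h.2⟩

lemma iInf_le_iSup_apply (y : Fin n → ℝ) : (⨅ i, y i) ≤ ⨆ i, y i :=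
  (ciInf_le (finite_range y).bddBelow 0).trans (le_ciSup (finite_range y).bddAbove 0)

lemma smul_mem_cube_iff {y : Fin n → ℝ} (hy : 0 < ⨅ i, y i) {t : ℝ} (ht : 0 < t) :
    t • y ∈ (univ.pi fun _ : Fin n => Ioo a b) ↔ t ∈ Ioo (a / ⨅ i, y i) (b / ⨆ i, y i) := by
  rw [mem_cube_iff, iSup_const_smul t ht.le, iInf_const_smul t ht.le, mem_Ioo, div_lt_iff₀ hy,
    lt_div_iff₀ (hy.trans_le (iInf_le_iSup_apply y))]

lemma cube_bounds (ha : 0 < a) {y : Fin n → ℝ} (hy : y ∈ univ.pi fun _ : Fin n => Ioo a b) :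
    0 < (⨅ i, y i) ∧ 0 < (⨆ i, y i) ∧ 0 < b ∧ a / (⨅ i, y i) < 1 ∧ 1 < b / (⨆ i, y i) := by
  obtain ⟨h1, h2⟩ := mem_cube_iff.1 hy
  have hm := ha.trans h1
  have hM := hm.trans_le (iInf_le_iSup_apply y)
  exact ⟨hm, hM, hM.trans h2, (div_lt_one hm).2 h1, (one_lt_div hM).2 h2⟩

lemma scaleMoment_pos (ha : 0 < a) {j : ℕ} (hj : j ≠ 0) {y : Fin n → ℝ}
    (hy : y ∈ univ.pi fun _ : Fin n => Ioo a b) : 0 < scaleMoment a b j y := by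
  obtain ⟨hm, hM, hb, h1, h2⟩ := cube_bounds ha hy
  have := pow_lt_pow_left₀ (h1.trans h2) (by positivity) hj
  exact div_pos (sub_pos.2 this) (by positivity)

lemma lintegral_indicator_smul (ha : 0 < a) {j : ℕ} (hj : j ≠ 0) {y : Fin n → ℝ}
    (hy : y ∈ univ.pi fun _ : Fin n => Ioo a b) :
    ∫⁻ t in Ioi (0 : ℝ), (univ.pi fun _ : Fin n => Ioo a b).indicator 1 (t • y)
        * ENNReal.ofReal (t ^ ((j : ℤ) - 1)) = ENNReal.ofReal (scaleMoment a b j y) := by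
  obtain ⟨hm, hM, hb, h1, h2⟩ := cube_bounds ha hy
  have hp : 0 < a / ⨅ i, y i := by positivity
  rw [scaleMoment]
  have := lintegral_zpow_Ioo hp (h1.trans h2).le (j := (j : ℤ) - 1) (by lia)
  simp only [sub_add_cancel, zpow_natCast, Int.cast_sub, Int.cast_natCast, Int.cast_one] at this
  rw [← this, ← lintegral_indicator measurableSet_Ioi, ← lintegral_indicator measurableSet_Ioo]
  refine lintegral_congr fun t => ?_
  by_cases ht : 0 < t
  · by_cases hc : t ∈ Ioo (a / ⨅ i, y i) (b / ⨆ i, y i)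
    · simp only [indicator_of_mem (mem_Ioi.2 ht), indicator_of_mem hc,
        indicator_of_mem ((smul_mem_cube_iff hm ht).2 hc), Pi.one_apply, one_mul]
    · simp only [indicator_of_mem (mem_Ioi.2 ht), indicator_of_notMem hc,
        indicator_of_notMem (mt (smul_mem_cube_iff hm ht).1 hc), zero_mul]
  · rw [indicator_of_notMem (by simpa using ht),
      indicator_of_notMem (fun h => ht (hp.trans h.1))]

lemma lintegral_indicator_inv_smul (ha : 0 < a) {j : ℕ} (hj : j ≠ 0) {y : Fin n → ℝ}
    (hy : y ∈ univ.pi fun _ : Fin n => Ioo a b) :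
    ∫⁻ t in Ioi (0 : ℝ), (univ.pi fun _ : Fin n => Ioo a b).indicator 1 (t⁻¹ • y)
        * ENNReal.ofReal (t ^ (-(j : ℤ) - 1)) = ENNReal.ofReal (scaleMoment a b j y) := by
  obtain ⟨hm, hM, hb, h1, h2⟩ := cube_bounds ha hy
  have hp : 0 < (⨆ i, y i) / b := by positivity
  have hpq : (⨆ i, y i) / b ≤ (⨅ i, y i) / a := by
    rw [← inv_div b, ← inv_div a]
    exact inv_anti₀ (by positivity) (h1.trans h2).le
  have hval : scaleMoment a b j y = (((⨅ i, y i) / a) ^ (-(j : ℤ) - 1 + 1)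
      - ((⨆ i, y i) / b) ^ (-(j : ℤ) - 1 + 1)) / ((-(j : ℤ) - 1 : ℤ) + 1) := by
    have hj' : (j : ℝ) ≠ 0 := by exact_mod_cast hj
    simp only [sub_add_cancel, zpow_neg, zpow_natCast, ← inv_pow, inv_div, scaleMoment]
    push_cast
    rw [sub_add_cancel, div_neg, ← neg_div, neg_sub]
  have hmem {t : ℝ} (ht : 0 < t) : t⁻¹ • y ∈ (univ.pi fun _ : Fin n => Ioo a b) ↔
      t ∈ Ioo ((⨆ i, y i) / b) ((⨅ i, y i) / a) := by
    rw [smul_mem_cube_iff hm (inv_pos.2 ht), mem_Ioo, mem_Ioo, and_comm,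
      ← inv_div b, ← inv_div a, inv_lt_comm₀ (by positivity) ht, lt_inv_comm₀ ht (by positivity)]
  rw [hval, ← lintegral_zpow_Ioo hp hpq (by lia), ← lintegral_indicator measurableSet_Ioi,
    ← lintegral_indicator measurableSet_Ioo]
  refine lintegral_congr fun t => ?_
  by_cases ht : 0 < t
  · by_cases hc : t ∈ Ioo ((⨆ i, y i) / b) ((⨅ i, y i) / a)
    · simp only [indicator_of_mem (mem_Ioi.2 ht), indicator_of_mem hc,
        indicator_of_mem ((hmem ht).2 hc), Pi.one_apply, one_mul]
    · simp only [indicator_of_mem (mem_Ioi.2 ht), indicator_of_notMem hc,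
        indicator_of_notMem (mt (hmem ht).1 hc), zero_mul]
  · rw [indicator_of_notMem (by simpa using ht),
      indicator_of_notMem (fun h => ht (hp.trans h.1))]

/-- The ratio of consecutive scale moments averages to `1` over the cube. -/
lemma setLIntegral_scaleMoment_div (ha : 0 < a) :
    ∫⁻ y in univ.pi fun _ : Fin n => Ioo a b,
        ENNReal.ofReal (scaleMoment a b n y / scaleMoment a b (n + 1) y)
      = volume (univ.pi fun _ : Fin n => Ioo a b) := by
  have hCm := measurableSet_cube (n := n) (a := a) (b := b)
  set C := univ.pi fun _ : Fin n => Ioo a b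
  let χ : (Fin n → ℝ) → ℝ≥0∞ := C.indicator 1
  have hχ : Measurable χ := measurable_one.indicator hCm
  let w : (Fin n → ℝ) → ℝ≥0∞ := fun y => ENNReal.ofReal (scaleMoment a b (n + 1) y)⁻¹
  have hw : Measurable w := (measurable_scaleMoment (n + 1)).inv.ennreal_ofReal
  calc _ = ∫⁻ y, ∫⁻ t in Ioi (0 : ℝ),
          χ y * w y * (χ (t • y) * ENNReal.ofReal (t ^ ((n : ℤ) - 1))) := by
        rw [← lintegral_indicator hCm]
        refine lintegral_congr fun y => ?_
        rw [lintegral_const_mul _ (by fun_prop)]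
        by_cases hy : y ∈ C
        · rw [lintegral_indicator_smul ha (NeZero.ne n) hy]
          simp only [χ, w, indicator_of_mem hy, Pi.one_apply, one_mul]
          rw [← ENNReal.ofReal_mul (inv_nonneg.2 (scaleMoment_pos ha n.succ_ne_zero hy).le),
            div_eq_inv_mul]
        · simp [χ, hy]
    _ = ∫⁻ t in Ioi (0 : ℝ), ∫⁻ y,
          χ y * w y * (χ (t • y) * ENNReal.ofReal (t ^ ((n : ℤ) - 1))) :=
        lintegral_lintegral_swap (by
          apply Measurable.aemeasurable
          unfold Function.uncurry
          fun_prop)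
    _ = ∫⁻ t in Ioi (0 : ℝ), ∫⁻ y,
          χ y * w y * (χ (t⁻¹ • y) * ENNReal.ofReal (t ^ (-((n + 1 : ℕ) : ℤ) - 1))) := by
        refine setLIntegral_congr_fun measurableSet_Ioi fun t (ht : 0 < t) => ?_
        have h := lintegral_comp_smul_pi ht (g := fun y : Fin n → ℝ =>
          χ (t⁻¹ • y) * w (t⁻¹ • y) * (χ y * ENNReal.ofReal (t ^ ((n : ℤ) - 1)))) (by fun_prop)
        simp only [inv_smul_smul₀ ht.ne'] at h
        rw [h, ← lintegral_const_mul _ (by fun_prop)]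
        refine lintegral_congr fun y => ?_
        have hwt : w (t⁻¹ • y) = ENNReal.ofReal ((t ^ (n + 1))⁻¹) * w y := by
          simp only [w]
          rw [← ENNReal.ofReal_mul (by positivity), scaleMoment_smul (inv_pos.2 ht), mul_inv,
            inv_pow, inv_inv]
        have ht' : ENNReal.ofReal (t ^ (-((n + 1 : ℕ) : ℤ) - 1))
            = ENNReal.ofReal ((t ^ n)⁻¹) * ENNReal.ofReal ((t ^ (n + 1))⁻¹)
              * ENNReal.ofReal (t ^ ((n : ℤ) - 1)) := by
          rw [← ENNReal.ofReal_mul (by positivity), ← ENNReal.ofReal_mul (by positivity)]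
          congr 1
          rw [← zpow_natCast, ← zpow_natCast, ← zpow_neg, ← zpow_neg, ← zpow_add₀ ht.ne',
            ← zpow_add₀ ht.ne']
          congr 1
          push_cast
          ring
        rw [hwt, ht']
        ring
    _ = ∫⁻ y, ∫⁻ t in Ioi (0 : ℝ),
          χ y * w y * (χ (t⁻¹ • y) * ENNReal.ofReal (t ^ (-((n + 1 : ℕ) : ℤ) - 1))) :=
        lintegral_lintegral_swap (by
          apply Measurable.aemeasurable
          unfold Function.uncurry
          fun_prop)
    _ = ∫⁻ y, χ y := by
        refine lintegral_congr fun y => ?_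
        rw [lintegral_const_mul _ (by fun_prop)]
        by_cases hy : y ∈ C
        · rw [lintegral_indicator_inv_smul ha n.succ_ne_zero hy]
          have hpos := scaleMoment_pos ha n.succ_ne_zero hy
          simp only [χ, w, indicator_of_mem hy, Pi.one_apply, one_mul]
          rw [← ENNReal.ofReal_mul (inv_nonneg.2 hpos.le), inv_mul_cancel₀ hpos.ne',
            ENNReal.ofReal_one]
        · simp [χ, hy]
    _ = volume C := lintegral_indicator_one hCm

end Cube

lemma measurable_thetaB2 (n : ℕ) (k : ℝ) : Measurable (thetaB2 n k) := by
  have h1 := measurable_iSup_apply (n := n)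
  have h2 := measurable_iInf_apply (n := n)
  unfold thetaB2
  fun_prop

lemma thetaB2_eq_scaleMoment_div {n : ℕ} [NeZero n] {k θ : ℝ} (hk : k ∈ Ioo (0 : ℝ) 1)
    (hθ : 0 < θ) {y : Fin n → ℝ}
    (hy : y ∈ univ.pi fun _ : Fin n => Ioo (θ * (1 - k)) (θ * (1 + k))) :
    thetaB2 n k y = θ * (scaleMoment (θ * (1 - k)) (θ * (1 + k)) n y
      / scaleMoment (θ * (1 - k)) (θ * (1 + k)) (n + 1) y) := by
  have hk1 : 0 < 1 - k := sub_pos.2 hk.2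
  have hk2 : 0 < 1 + k := by linarith [hk.1]
  obtain ⟨hm, hM, -, h1, h2⟩ := cube_bounds (mul_pos hθ hk1) hy
  have hn : (n : ℝ) ≠ 0 := NeZero.ne _
  unfold thetaB2
  unfold scaleMoment
  set m := ⨅ i, y i
  set M := ⨆ i, y i
  set p := θ * (1 - k) / m with hp
  set q := θ * (1 + k) / M with hq
  have hp0 : 0 < p := by positivity
  have hq0 : 0 < q := by positivity
  have hM' : M / (1 + k) = θ / q := by rw [hq]; field_simp
  have hm' : m / (1 - k) = θ / p := by rw [hp]; field_simp
  have hb : m / (1 - k) / (M / (1 + k)) = q / p := by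
    rw [hM', hm']; field_simp
  rw [hb, hM', show -(n : ℤ) - 1 = -((n + 1 : ℕ) : ℤ) by push_cast; ring, zpow_neg, zpow_neg,
    zpow_natCast, zpow_natCast, ← inv_pow, ← inv_pow, inv_div, div_pow p, div_pow p]
  have hlt : p ^ (n + 1) < q ^ (n + 1) := pow_lt_pow_left₀ (h1.trans h2) hp0.le n.succ_ne_zero
  have hne : q ^ (n + 1) - p ^ (n + 1) ≠ 0 := (sub_pos.2 hlt).ne'
  rw [one_sub_div (by positivity), one_sub_div (by positivity)]
  push_cast
  field_simp
  ring

lemma pi_unifIcc (n : ℕ) {a b : ℝ} (hab : a < b) :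
    (Measure.pi fun _ : Fin n => unifIcc a b)
      = (ENNReal.ofReal (b - a))⁻¹ ^ n • volume.restrict (univ.pi fun _ : Fin n => Ioo a b) := by
  have hfin : (ENNReal.ofReal (b - a))⁻¹ ≠ ∞ := by simpa using hab
  have : SigmaFinite (unifIcc a b) := by
    have : IsFiniteMeasure (unifIcc a b) := Measure.smul_finite _ hfin
    infer_instance
  refine Measure.pi_eq fun s hs => ?_
  rw [volume_pi, Measure.restrict_pi_pi, Measure.smul_apply, Measure.pi_pi]
  simp only [unifIcc, Measure.smul_apply, smul_eq_mul, Finset.prod_mul_distrib,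
    Finset.prod_const, Finset.card_univ, Fintype.card_fin, Measure.restrict_congr_set Ioo_ae_eq_Icc]

/-- For `Y_1, …, Y_n` i.i.d. uniform on `[θ(1-k), θ(1+k)]`, the generalized
Bayes estimator `θ̂_B2` is unbiased: `E[θ̂_B2] = θ` for every `θ > 0`. -/
theorem stmt_11 (n : ℕ) (hn : 2 ≤ n) (k : ℝ) (hk : k ∈ Set.Ioo (0:ℝ) 1)
    (θ : ℝ) (hθ : 0 < θ) :
    (∫ y : Fin n → ℝ, thetaB2 n k y
        ∂(Measure.pi fun _ : Fin n => unifIcc (θ * (1 - k)) (θ * (1 + k)))) = θ := by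
  have : NeZero n := ⟨by lia⟩
  have ha : 0 < θ * (1 - k) := mul_pos hθ (sub_pos.2 hk.2)
  have hab : θ * (1 - k) < θ * (1 + k) := mul_lt_mul_of_pos_left (by linarith [hk.1]) hθ
  have hCm := measurableSet_cube (n := n) (a := θ * (1 - k)) (b := θ * (1 + k))
  have hnn : ∀ y ∈ (univ.pi fun _ : Fin n => Ioo (θ * (1 - k)) (θ * (1 + k))),
      0 ≤ thetaB2 n k y := fun y hy => by
    rw [thetaB2_eq_scaleMoment_div hk hθ hy]
    exact mul_nonneg hθ.le (div_nonneg (scaleMoment_pos ha (NeZero.ne n) hy).le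
      (scaleMoment_pos ha n.succ_ne_zero hy).le)
  have hmeas : Measurable fun y : Fin n → ℝ => ENNReal.ofReal
      (scaleMoment (θ * (1 - k)) (θ * (1 + k)) n y
        / scaleMoment (θ * (1 - k)) (θ * (1 + k)) (n + 1) y) :=
    ((measurable_scaleMoment n).div (measurable_scaleMoment (n + 1))).ennreal_ofReal
  have hval : ∫⁻ y in univ.pi fun _ : Fin n => Ioo (θ * (1 - k)) (θ * (1 + k)),
      ENNReal.ofReal (thetaB2 n k y)
        = ENNReal.ofReal θ * ENNReal.ofReal (θ * (1 + k) - θ * (1 - k)) ^ n := by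
    rw [setLIntegral_congr_fun (g := fun y => ENNReal.ofReal θ * ENNReal.ofReal
      (scaleMoment (θ * (1 - k)) (θ * (1 + k)) n y
        / scaleMoment (θ * (1 - k)) (θ * (1 + k)) (n + 1) y)) hCm fun y hy => by
          simp only [thetaB2_eq_scaleMoment_div hk hθ hy, ENNReal.ofReal_mul hθ.le],
      lintegral_const_mul _ hmeas,
      setLIntegral_scaleMoment_div ha, volume_pi, Measure.pi_pi]
    simp
  rw [pi_unifIcc n hab, integral_smul_measure, integral_eq_lintegral_of_nonneg_ae
    ((ae_restrict_iff' hCm).2 (.of_forall hnn)) (measurable_thetaB2 n k).aestronglyMeasurable,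
    hval, smul_eq_mul, ← ENNReal.toReal_mul, mul_left_comm, ← mul_pow,
    ENNReal.inv_mul_cancel (by simpa using hab) ENNReal.ofReal_ne_top, one_pow, mul_one,
    ENNReal.toReal_ofReal hθ.le]
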